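/- Let β > 0, ρ ∈ [0, 1/2], μ ∈ (0, 2π]. For k ∈ ℕ and 0 ≤ s ≤ k set u_{k,s}(θ) = C(β, k)·C(k, s)·(1/(2π))^(β−k)·(ρ/π)^k·θ^(β−k)·cos(θ − μ)·[ (sin μ)^s·(sin(θ − μ))^(k−s+1)·M₀(θ) + (sin μ)^(k−s)·(sin(θ − μ))^(s+1)·M₁(θ) ], where M₀(θ) = 1 if |sin(θ − μ)| ≥ |sin(μ)| and 0 otherwise, and M₁ = 1 − M₀. Assume each u_{k,s} is integrable on (0, 2π) and ∑_{k=0}^∞ ∑_{s=0}^{k} ∫₀^{2π} |u_{k,s}(θ)| dθ < ∞. Then the second cosine moment satisfies α₂ := ∫₀^{2π} cos(2(θ − μ))·f(θ) dθ = cos(2μ) + 4·∑_{k=0}^∞ ∑_{s=0}^{k} ∫₀^{2π} u_{k,s}(θ) dθ. -/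

import Mathlib

open Real MeasureTheory

/-- Generalized binomial coefficient `C(β, k) = β (β-1) ⋯ (β-k+1) / k!`. -/
noncomputable def genBinom (β : ℝ) (k : ℕ) : ℝ :=
  (∏ i ∈ Finset.range k, (β - i)) / (Nat.factorial k)

lemma genBinom_eq_choose (β : ℝ) (k : ℕ) : genBinom β k = Ring.choose β k := by
  rw [Ring.choose_eq_smul, genBinom, ← descPochhammer_eval_eq_prod_range,
    ← Polynomial.eval₂_smulOneHom_eq_smeval, Polynomial.eval₂_eq_eval_map, smul_eq_mul,
    descPochhammer_map, div_eq_inv_mul]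

lemma hasSum_binom (β t : ℝ) (ht : |t| < 1) :
    HasSum (fun k : ℕ => genBinom β k * t ^ k) ((1 + t) ^ β) := by
  have h := (Real.one_add_rpow_hasFPowerSeriesOnBall_zero (a := β)).hasSum (y := t)
    (by simpa [Metric.mem_eball, edist_dist, Real.dist_eq] using ht)
  rw [zero_add] at h
  refine Eq.mp (congrArg (fun g => HasSum g _) (funext fun k => Eq.symm ?_)) h
  rw [binomialSeries_apply, genBinom_eq_choose, List.ofFn_const, List.prod_replicate, smul_eq_mul]

lemma hasSum_binom_xy (β x y : ℝ) (hx : 0 < x) (hxy : |y| < x) :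
    HasSum (fun k : ℕ => genBinom β k * (x ^ (β - (k : ℝ)) * y ^ k)) ((x + y) ^ β) := by
  have h1 : |y / x| < 1 := by
    rw [abs_div, abs_of_pos hx]; exact (div_lt_one hx).2 hxy
  have h2 := (hasSum_binom β (y / x) h1).mul_left (x ^ β)
  have h3 : x ^ β * (1 + y / x) ^ β = (x + y) ^ β := by
    rw [← Real.mul_rpow hx.le (by linarith [(abs_lt.1 h1).1])]
    congr 1
    field_simp
  rw [h3] at h2
  refine Eq.mp (congrArg (fun g => HasSum g _) (funext fun k => Eq.symm ?_)) h2
  rw [Real.rpow_sub hx, Real.rpow_natCast, div_pow]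
  ring

lemma sin_bound (θ μ : ℝ) (h : 0 < θ) : |Real.sin (θ - μ) + Real.sin μ| < θ := by
  have : Real.sin (θ - μ) + Real.sin μ = 2 * Real.sin (θ / 2) * Real.cos ((θ - 2 * μ) / 2) := by
    have := Real.sin_sub_sin (θ - μ) (-μ)
    rw [Real.sin_neg] at this
    ring_nf at this ⊢
    exact this
  rw [this, abs_mul, abs_mul, abs_two]
  have h1 := Real.abs_sin_lt_abs (x := θ / 2) (by positivity)
  rw [abs_of_pos (half_pos h)] at h1
  have h2 := Real.abs_cos_le_one ((θ - 2 * μ) / 2)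
  have h3 := abs_nonneg (Real.sin (θ / 2))
  nlinarith

lemma y_bound (ρ θ μ : ℝ) (hρ0 : 0 ≤ ρ) (hρ1 : ρ ≤ 1 / 2) (h : 0 < θ) :
    |(ρ / π) * (Real.sin (θ - μ) + Real.sin μ)| < θ / (2 * π) := by
  have hb := sin_bound θ μ h
  have hp := Real.pi_pos
  rw [abs_mul, abs_of_nonneg (by positivity)]
  have : ρ / π ≤ 1 / (2 * π) := by
    rw [div_le_div_iff₀ hp (by positivity)]; nlinarith
  calc ρ / π * |Real.sin (θ - μ) + Real.sin μ|
      ≤ 1 / (2 * π) * |Real.sin (θ - μ) + Real.sin μ| := by gcongr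
    _ < 1 / (2 * π) * θ := by gcongr
    _ = _ := by ring

lemma binom_term (S m : ℝ) (c : Prop) [Decidable c] (k : ℕ) :
    ∑ s ∈ Finset.range (k + 1), (Nat.choose k s : ℝ) *
      (m ^ s * S ^ (k - s + 1) * (if c then (1 : ℝ) else 0) +
        m ^ (k - s) * S ^ (s + 1) * (1 - if c then (1 : ℝ) else 0)) = S * (S + m) ^ k := by
  by_cases h : c
  · simp only [h, if_true]
    rw [add_comm S m, add_pow, Finset.mul_sum]
    refine Finset.sum_congr rfl fun s _ => ?_
    ring
  · simp only [h, if_false]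
    rw [add_pow, Finset.mul_sum]
    refine Finset.sum_congr rfl fun s _ => ?_
    ring

lemma parts (β ρ μ : ℝ) (hβ : 0 < β) (hρ0 : 0 ≤ ρ) (hρ1 : ρ ≤ 1 / 2) :
    ∫ θ in (0 : ℝ)..(2 * π),
        Real.cos (2 * (θ - μ)) *
          ((β / (2 * π)) *
            (θ / (2 * π) + (ρ / π) * (Real.sin (θ - μ) + Real.sin μ)) ^ (β - 1) *
            (1 + 2 * ρ * Real.cos (θ - μ))) =
      Real.cos (2 * μ) + 4 * ∫ θ in (0 : ℝ)..(2 * π), Real.cos (θ - μ) * Real.sin (θ - μ) *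
        (θ / (2 * π) + (ρ / π) * (Real.sin (θ - μ) + Real.sin μ)) ^ β := by
  have hp := Real.pi_pos
  set G : ℝ → ℝ := fun θ => θ / (2 * π) + (ρ / π) * (Real.sin (θ - μ) + Real.sin μ) with hG
  set f : ℝ → ℝ := fun θ => (β / (2 * π)) * (G θ) ^ (β - 1) * (1 + 2 * ρ * Real.cos (θ - μ)) with hf
  have hGpos : ∀ θ, 0 < θ → 0 < G θ := fun θ h => by
    have := (abs_lt.1 (y_bound ρ θ μ hρ0 hρ1 h)).1
    simp only [hG]; linarith
  have hGc : Continuous G := by simp only [hG]; fun_prop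
  have hFc : Continuous fun θ => (G θ) ^ β := hGc.rpow_const fun _ => Or.inr hβ.le
  have hGd : ∀ θ, HasDerivAt G (1 / (2 * π) + (ρ / π) * Real.cos (θ - μ)) θ := fun θ => by
    have h1 : HasDerivAt (fun θ : ℝ => Real.sin (θ - μ)) (Real.cos (θ - μ)) θ := by
      simpa using ((hasDerivAt_id θ).sub_const μ).sin
    exact ((hasDerivAt_id θ).div_const (2 * π)).add ((h1.add_const (Real.sin μ)).const_mul (ρ / π))
  have hFd : ∀ θ ∈ Set.Ioo 0 (2 * π), HasDerivAt (fun θ => (G θ) ^ β) (f θ) θ := fun θ h => by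
    have := (hGd θ).rpow_const (p := β) (Or.inl (hGpos θ h.1).ne')
    convert this using 1
    simp only [hf]
    field_simp
  have hfpos : ∀ θ ∈ Set.Ioo 0 (2 * π), 0 ≤ f θ := fun θ h => by
    have h1 := hGpos θ h.1
    have h2 : 0 ≤ 1 + 2 * ρ * Real.cos (θ - μ) := by
      nlinarith [Real.neg_one_le_cos (θ - μ)]
    simp only [hf]
    positivity
  have hfi : IntervalIntegrable f volume 0 (2 * π) := by
    rw [intervalIntegrable_iff_integrableOn_Ioc_of_le (by positivity)]
    exact intervalIntegral.integrableOn_deriv_of_nonneg hFc.continuousOn hFd hfpos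
  have hcd : ∀ θ, HasDerivAt (fun θ : ℝ => Real.cos (2 * (θ - μ)))
      (-(4 * (Real.cos (θ - μ) * Real.sin (θ - μ)))) θ := fun θ => by
    have := ((((hasDerivAt_id θ).sub_const μ).const_mul 2)).cos
    refine HasDerivAt.congr_deriv this ?_
    rw [Real.sin_two_mul, id_eq]
    ring
  have hi1 : IntervalIntegrable (fun θ => Real.cos (2 * (θ - μ)) * f θ) volume 0 (2 * π) :=
    hfi.continuousOn_mul (by fun_prop)
  have hi2 : IntervalIntegrable (fun θ => 4 * (Real.cos (θ - μ) * Real.sin (θ - μ) * (G θ) ^ β))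
      volume 0 (2 * π) := by
    apply Continuous.intervalIntegrable
    exact continuous_const.mul (Continuous.mul (by fun_prop) hFc)
  have key := intervalIntegral.integral_eq_sub_of_hasDerivAt_of_le (a := 0) (b := 2 * π)
    (f := fun θ => Real.cos (2 * (θ - μ)) * (G θ) ^ β)
    (f' := fun θ => Real.cos (2 * (θ - μ)) * f θ -
      4 * (Real.cos (θ - μ) * Real.sin (θ - μ) * (G θ) ^ β)) (by positivity)
    (Continuous.continuousOn (Continuous.mul (by fun_prop) hFc))
    (fun θ h => by
      refine ((hcd θ).mul (hFd θ h)).congr_deriv ?_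
      ring) (hi1.sub hi2)
  rw [intervalIntegral.integral_sub hi1 hi2, intervalIntegral.integral_const_mul] at key
  have hG0 : G 0 = 0 := by simp [hG]
  have hG1 : G (2 * π) = 1 := by
    simp only [hG, Real.sin_two_pi_sub]
    field_simp
    ring
  have hc : Real.cos (2 * (2 * π - μ)) = Real.cos (2 * μ) := by
    rw [show 2 * (2 * π - μ) = 2 * π - 2 * μ + 2 * π by ring, Real.cos_add_two_pi,
      Real.cos_two_pi_sub]
  simp only [hG0, hG1, hc, Real.one_rpow, Real.zero_rpow hβ.ne'] at key
  linarith


theorem ec_second_cos_moment (β ρ μ : ℝ) (hβ : 0 < β) (hρ0 : 0 ≤ ρ) (hρ1 : ρ ≤ 1 / 2)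
    (hμ0 : 0 < μ) (hμ1 : μ ≤ 2 * π) (u : ℕ → ℕ → ℝ → ℝ)
    (hu : ∀ k s : ℕ, s ≤ k → ∀ θ : ℝ,
      u k s θ = genBinom β k * (Nat.choose k s : ℝ) * (1 / (2 * π)) ^ (β - (k : ℝ)) *
        (ρ / π) ^ k * θ ^ (β - (k : ℝ)) * Real.cos (θ - μ) *
        ((Real.sin μ) ^ s * (Real.sin (θ - μ)) ^ (k - s + 1) *
            (if |Real.sin (θ - μ)| ≥ |Real.sin μ| then (1 : ℝ) else 0) +
          (Real.sin μ) ^ (k - s) * (Real.sin (θ - μ)) ^ (s + 1) *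
            (1 - if |Real.sin (θ - μ)| ≥ |Real.sin μ| then (1 : ℝ) else 0)))
    (hint : ∀ k s : ℕ, s ≤ k → IntegrableOn (u k s) (Set.Ioo 0 (2 * π)) volume)
    (hsum : Summable fun k : ℕ =>
      ∑ s ∈ Finset.range (k + 1), ∫ θ in (0 : ℝ)..(2 * π), |u k s θ|) :
    ∫ θ in (0 : ℝ)..(2 * π),
        Real.cos (2 * (θ - μ)) *
          ((β / (2 * π)) *
            (θ / (2 * π) + (ρ / π) * (Real.sin (θ - μ) + Real.sin μ)) ^ (β - 1) *
            (1 + 2 * ρ * Real.cos (θ - μ))) =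
      Real.cos (2 * μ) +
        4 * ∑' k : ℕ, ∑ s ∈ Finset.range (k + 1), ∫ θ in (0 : ℝ)..(2 * π), u k s θ := by
  rw [parts β ρ μ hβ hρ0 hρ1]
  congr 2
  have hp := Real.pi_pos
  have h2p : (0 : ℝ) ≤ 2 * π := by positivity
  have hpt : ∀ θ ∈ Set.Ioo 0 (2 * π), HasSum (fun k : ℕ => ∑ s ∈ Finset.range (k + 1), u k s θ)
      (Real.cos (θ - μ) * Real.sin (θ - μ) *
        (θ / (2 * π) + (ρ / π) * (Real.sin (θ - μ) + Real.sin μ)) ^ β) := by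
    intro θ hθ
    have hx : 0 < θ / (2 * π) := div_pos hθ.1 (by positivity)
    have h := (hasSum_binom_xy β _ _ hx (y_bound ρ θ μ hρ0 hρ1 hθ.1)).mul_left
      (Real.cos (θ - μ) * Real.sin (θ - μ))
    refine Eq.mp (congrArg (fun g => HasSum g _) (funext fun k => Eq.symm ?_)) h
    have hb := binom_term (Real.sin (θ - μ)) (Real.sin μ)
      (|Real.sin (θ - μ)| ≥ |Real.sin μ|) k
    have hxx : (θ / (2 * π)) ^ (β - (k : ℝ)) =
        (1 / (2 * π)) ^ (β - (k : ℝ)) * θ ^ (β - (k : ℝ)) := by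
      rw [← Real.mul_rpow (by positivity) hθ.1.le]
      congr 1
      ring
    rw [hxx, mul_pow]
    calc _ = ∑ s ∈ Finset.range (k + 1), (genBinom β k * (1 / (2 * π)) ^ (β - (k : ℝ)) *
        (ρ / π) ^ k * θ ^ (β - (k : ℝ)) * Real.cos (θ - μ)) * ((Nat.choose k s : ℝ) *
      ((Real.sin μ) ^ s * (Real.sin (θ - μ)) ^ (k - s + 1) *
            (if |Real.sin (θ - μ)| ≥ |Real.sin μ| then (1 : ℝ) else 0) +
          (Real.sin μ) ^ (k - s) * (Real.sin (θ - μ)) ^ (s + 1) *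
            (1 - if |Real.sin (θ - μ)| ≥ |Real.sin μ| then (1 : ℝ) else 0))) := by
          refine Finset.sum_congr rfl fun s hs => ?_
          rw [hu k s (by simpa [Nat.lt_succ_iff] using hs)]
          ring
      _ = _ := by
          rw [← Finset.mul_sum, hb]
          ring
  simp only [intervalIntegral.integral_of_le h2p, integral_Ioc_eq_integral_Ioo] at hsum ⊢
  have hint' : ∀ k, ∀ s ∈ Finset.range (k + 1),
      Integrable (u k s) (volume.restrict (Set.Ioo 0 (2 * π))) := fun k s hs =>
    hint k s (by simpa [Nat.lt_succ_iff] using hs)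
  have hi : ∀ k : ℕ, Integrable (fun θ => ∑ s ∈ Finset.range (k + 1), u k s θ)
      (volume.restrict (Set.Ioo 0 (2 * π))) := fun k => integrable_finsetSum _ (hint' k)
  have hs : Summable fun k : ℕ => ∫ θ in Set.Ioo 0 (2 * π),
      ‖∑ s ∈ Finset.range (k + 1), u k s θ‖ := by
    refine Summable.of_nonneg_of_le (fun k => by positivity) (fun k => ?_) hsum
    rw [← integral_finsetSum _ fun s hs => (hint' k s hs).abs]
    refine integral_mono (hi k).norm
      (integrable_finsetSum _ fun s hs => (hint' k s hs).abs) fun θ => ?_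
    exact norm_sum_le _ _
  have hfin := (hasSum_integral_of_summable_integral_norm hi hs).tsum_eq
  simp only [fun k => integral_finsetSum _ (hint' k)] at hfin
  rw [hfin]
  refine setIntegral_congr_fun measurableSet_Ioo fun θ hθ => ?_
  exact ((hpt θ hθ).tsum_eq).symm
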